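/- In the braid group Br_n, for all indices 1 ≤ i < j < k ≤ n the band generators satisfy the conjugation identity σ_{i,k}³ = (σ_{j,k}³ σ_{i,j}² σ_{i,k}² σ_{i,j}^{-2}) · σ_{i,j}³ · (σ_{j,k}³ σ_{i,j}² σ_{i,k}² σ_{i,j}^{-2})^{-1}; indeed already σ_{i,k} = (σ_{j,k}³ σ_{i,j}² σ_{i,k}² σ_{i,j}^{-2}) · σ_{i,j} · (σ_{j,k}³ σ_{i,j}² σ_{i,k}² σ_{i,j}^{-2})^{-1}. -/

import Mathlib

open FreeGroup

namespace BraidPresented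

/-- The braid relations among `g` abstract Artin generators `σ_0, …, σ_{g-1}`. -/
def braidRels (g : ℕ) : Set (FreeGroup (Fin g)) :=
  { r | (∃ i j : Fin g, (i : ℕ) + 1 = (j : ℕ) ∧
          r = of i * of j * of i * (of j * of i * of j)⁻¹) ∨
        (∃ i j : Fin g, (i : ℕ) + 1 < (j : ℕ) ∧ r = of i * of j * (of j * of i)⁻¹) }

/-- The braid group on `g + 1` strands, presented by `g` Artin generators. -/
abbrev BraidP (g : ℕ) := PresentedGroup (braidRels g)

/-- The `k`-th Artin generator of the presented braid group (`1` when out of range). -/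
def pgen (g : ℕ) (k : ℕ) : BraidP g :=
  if h : k < g then PresentedGroup.of ⟨k, h⟩ else 1

/-- The band generator `σ_{i,j} = (σ_{j-1} ⋯ σ_{i+1}) σ_i (σ_{j-1} ⋯ σ_{i+1})⁻¹`
(0-indexed strands `i < j`). -/
def pband (g : ℕ) (i j : ℕ) : BraidP g :=
  (((List.range (j - (i + 1))).map fun k => pgen g (j - 1 - k)).prod) * pgen g i *
    (((List.range (j - (i + 1))).map fun k => pgen g (j - 1 - k)).prod)⁻¹


/-- Artin generators at distance at least two commute. -/
theorem pgen_commute (g : ℕ) {k m : ℕ} (h : k + 1 < m) : Commute (pgen g k) (pgen g m) := by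
  by_cases hm : m < g
  · have hk : k < g := by omega
    have hrel : of (⟨k, hk⟩ : Fin g) * of ⟨m, hm⟩ * (of ⟨m, hm⟩ * of ⟨k, hk⟩)⁻¹ ∈ braidRels g :=
      Or.inr ⟨⟨k, hk⟩, ⟨m, hm⟩, h, rfl⟩
    simpa only [pgen, hk, hm, dite_true, commute_iff_eq] using
      mul_inv_eq_one.1 (PresentedGroup.one_of_mem hrel)
  · simp [pgen, hm]

/-- Consecutive Artin generators satisfy the braid relation. -/
theorem pgen_braid {g k : ℕ} (h : k + 1 < g) :
    pgen g k * pgen g (k + 1) * pgen g k = pgen g (k + 1) * pgen g k * pgen g (k + 1) := by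
  have hk : k < g := by omega
  have hrel : of (⟨k, hk⟩ : Fin g) * of ⟨k + 1, h⟩ * of ⟨k, hk⟩ *
      (of ⟨k + 1, h⟩ * of ⟨k, hk⟩ * of ⟨k + 1, h⟩)⁻¹ ∈ braidRels g :=
    Or.inl ⟨⟨k, hk⟩, ⟨k + 1, h⟩, rfl, rfl⟩
  simpa only [pgen, hk, h, dite_true] using
    mul_inv_eq_one.1 (PresentedGroup.one_of_mem hrel)

theorem pband_succ_self (g i : ℕ) : pband g i (i + 1) = pgen g i := by
  simp [pband]

/-- Moving the upper strand of a band generator up by one is conjugation by an Artin generator. -/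
theorem pband_succ (g : ℕ) {i j : ℕ} (h : i < j) :
    pband g i (j + 1) = pgen g j * pband g i j * (pgen g j)⁻¹ := by
  have hlen : j + 1 - (i + 1) = (j - (i + 1)) + 1 := by omega
  have hidx : (fun k => pgen g (j - (k + 1))) = fun k => pgen g (j - 1 - k) := by
    funext k; congr 1; omega
  simp only [pband, hlen, List.range_succ_eq_map, List.map_cons, List.map_map, List.prod_cons,
    Function.comp_def, Nat.succ_eq_add_one, hidx, Nat.add_sub_cancel, Nat.sub_zero, mul_inv_rev,
    mul_assoc]

/-- An Artin generator whose strands lie above those of a band generator commutes with it. -/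
theorem pband_commute_pgen (g : ℕ) {i j m : ℕ} (hij : i < j) (hjm : j < m) :
    Commute (pband g i j) (pgen g m) := by
  induction j, hij using Nat.le_induction with
  | base => exact pband_succ_self g i ▸ pgen_commute g hjm
  | succ j hij ih =>
    rw [pband_succ g hij]
    have hj := pgen_commute g hjm
    exact (hj.mul_left (ih (by omega))).mul_left hj.inv_left

/-- If `s` braids with `a` and `t`, and `a` commutes with `t`, then `s a s⁻¹` braids with `t`. -/
theorem braid_conj {G : Type*} [Group G] {a s t : G} (has : a * s * a = s * a * s)
    (hst : s * t * s = t * s * t) (hat : Commute a t) :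
    (s * a * s⁻¹) * t * (s * a * s⁻¹) = t * (s * a * s⁻¹) * t := by
  have hx : s * a * s⁻¹ = a⁻¹ * s * a := by
    rw [mul_inv_eq_iff_eq_mul, mul_assoc, mul_assoc, eq_inv_mul_iff_mul_eq]
    simpa only [mul_assoc] using has
  have ht : t = a⁻¹ * t * a := by rw [mul_assoc, ← hat.eq, inv_mul_cancel_left]
  rw [hx]
  calc a⁻¹ * s * a * t * (a⁻¹ * s * a)
      = a⁻¹ * s * a * (a⁻¹ * t * a) * (a⁻¹ * s * a) := by rw [← ht]
    _ = a⁻¹ * (s * t * s) * a := by group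
    _ = a⁻¹ * (t * s * t) * a := by rw [hst]
    _ = (a⁻¹ * t * a) * (a⁻¹ * s * a) * (a⁻¹ * t * a) := by group
    _ = t * (a⁻¹ * s * a) * t := by rw [← ht]

/-- A band generator braids with the Artin generator starting at its upper strand. -/
theorem pband_braid_pgen {g i j : ℕ} (hij : i < j) (hj : j < g) :
    pband g i j * pgen g j * pband g i j = pgen g j * pband g i j * pgen g j := by
  induction j, hij using Nat.le_induction with
  | base => rw [Nat.succ_eq_add_one, pband_succ_self]; exact pgen_braid hj
  | succ j hij ih =>
    rw [pband_succ g hij]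
    exact braid_conj (ih (by omega)) (pgen_braid hj) (pband_commute_pgen g hij (by omega))

/-- Band generators sharing the strand `j` braid, and `σ_{i,k}` is the conjugate of `σ_{i,j}`
by `σ_{j,k}`. -/
theorem pband_braid_and_conj {g i j k : ℕ} (hij : i < j) (hjk : j < k) (hk : k ≤ g) :
    pband g i j * pband g j k * pband g i j = pband g j k * pband g i j * pband g j k ∧
      pband g i k = pband g j k * pband g i j * (pband g j k)⁻¹ := by
  induction k, hjk using Nat.le_induction with
  | base =>
    rw [Nat.succ_eq_add_one, pband_succ_self, pband_succ g hij]
    exact ⟨pband_braid_pgen hij hk, rfl⟩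
  | succ k hjk ih =>
    obtain ⟨hb, hx⟩ := ih (by omega)
    have hc : pgen g k * pband g i j * (pgen g k)⁻¹ = pband g i j := by
      rw [← (pband_commute_pgen g hij hjk).eq, mul_inv_cancel_right]
    rw [pband_succ g hjk, pband_succ g (hij.trans hjk), hx]
    have hb' := congrArg (fun x => pgen g k * x * (pgen g k)⁻¹) hb
    simp only [← conj_mul, hc] at hb'
    refine ⟨hb', ?_⟩
    nth_rw 2 [← hc]
    group

/-- The conjugation identity in a group generated by two braiding elements. -/
theorem conj_eq_of_braid {G : Type*} [Group G] {a b x : G} (hab : a * b * a = b * a * b)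
    (hx : x = b * a * b⁻¹) :
    x * (b ^ 3 * a ^ 2 * x ^ 2 * (a ^ 2)⁻¹) = b ^ 3 * a ^ 2 * x ^ 2 * (a ^ 2)⁻¹ * a := by
  have hx' : x = a⁻¹ * b * a := by
    rw [hx, mul_inv_eq_iff_eq_mul, mul_assoc, mul_assoc, eq_inv_mul_iff_mul_eq]
    simpa only [mul_assoc] using hab
  have hc : b ^ 3 * a ^ 2 * x ^ 2 * (a ^ 2)⁻¹ = b ^ 3 * a * b ^ 2 * a⁻¹ := by
    rw [hx']; simp only [pow_succ, pow_zero]; group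
  have hcomm : a * (b ^ 2 * a * b ^ 2) = b ^ 2 * a * b ^ 2 * a := by
    calc a * (b ^ 2 * a * b ^ 2) = a * b * (b * a * b) * b := by simp only [pow_two, mul_assoc]
      _ = (a * b * a) * (b * a * b) := by nth_rw 1 [← hab]; simp only [mul_assoc]
      _ = (b * a * b) * (a * b * a) := by rw [hab]
      _ = b * (a * b * a) * b * a := by simp only [mul_assoc]
      _ = b ^ 2 * a * b ^ 2 * a := by rw [hab]; simp only [pow_two, mul_assoc]
  rw [hc, hx]
  calc b * a * b⁻¹ * (b ^ 3 * a * b ^ 2 * a⁻¹) = b * (a * (b ^ 2 * a * b ^ 2)) * a⁻¹ := by group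
    _ = b ^ 3 * a * b ^ 2 * a⁻¹ * a := by rw [hcomm]; group

/-- In `Br_n`, for `i < j < k` (0-indexed strands `< n`), with
`c = σ_{j,k}³ σ_{i,j}² σ_{i,k}² σ_{i,j}⁻²` one has `σ_{i,k}³ = c σ_{i,j}³ c⁻¹`, and indeed
already `σ_{i,k} = c σ_{i,j} c⁻¹`. -/
theorem statement16 (n i j k : ℕ) (hij : i < j) (hjk : j < k) (hkn : k < n)
    (c : BraidP (n - 1))
    (hc : c = pband (n - 1) j k ^ 3 * pband (n - 1) i j ^ 2 * pband (n - 1) i k ^ 2 *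
      (pband (n - 1) i j ^ 2)⁻¹) :
    pband (n - 1) i k ^ 3 = c * pband (n - 1) i j ^ 3 * c⁻¹ ∧
    pband (n - 1) i k = c * pband (n - 1) i j * c⁻¹ := by
  obtain ⟨hb, hx⟩ := pband_braid_and_conj (g := n - 1) hij hjk (by omega)
  have h : pband (n - 1) i k = c * pband (n - 1) i j * c⁻¹ := by
    rw [eq_mul_inv_iff_mul_eq, hc]
    exact conj_eq_of_braid hb hx
  exact ⟨by rw [h, conj_pow], h⟩

end BraidPresented
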